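/- arXiv:1307.0938 — 6 statements merged into one kernel-verified Lean document; each statement's English description precedes it below -/
import Mathlib

section
/- Let ρ be a real number with |ρ| < 1, σ > 0, and β ∈ [0,1). For each n ≥ 2 let M_n be the n×n matrix with entries (M_n)_{11} = (M_n)_{nn} = 1/σ², (M_n)_{ii} = (1+ρ²)/σ² for 1 < i < n, (M_n)_{i,i+1} = (M_n)_{i+1,i} = −ρ/σ², and 0 elsewhere (the inverse of the stationary AR(1) covariance matrix). Define t_{n,β} = Σ_{i=⌊nβ⌋+1}^{n} Σ_{j=⌊nβ⌋+1}^{n} (M_n)_{ij}. Then t_{n,β}/(n(1−β)) → ((1−ρ)/σ)² as n → ∞. -/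
open Matrix Filter

/-- Sum over the trailing principal block `{k, …, n-1}²` of a tridiagonal matrix with diagonal `a`,
off-diagonal `b`, and corner entries `a - r`. -/
lemma sum_trailing_block_tridiagonal (a b r : ℝ) {n k : ℕ} (hn : 2 ≤ n) (hk : k < n)
    (A : Matrix (Fin n) (Fin n) ℝ)
    (hA : ∀ i j : Fin n, A i j =
      if i = j then (if i.val = 0 ∨ i.val = n - 1 then a - r else a)
      else if Nat.dist i.val j.val = 1 then b else 0) :
    (∑ i : Fin n, ∑ j : Fin n, if k ≤ i.val ∧ k ≤ j.val then A i j else 0) =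
      ((n : ℝ) - k) * (a + 2 * b) - ((if k = 0 then r else 0) + r + 2 * b) := by
  have entry : ∀ i j : Fin n, (if k ≤ i.val ∧ k ≤ j.val then A i j else 0) =
      (if i.val = j.val then (if k ≤ i.val then a else 0) - (if i.val = 0 then
          (if k = 0 then r else 0) else 0) - (if i.val = n - 1 then r else 0) else 0)
        + (if i.val + 1 = j.val then (if k ≤ i.val then b else 0) else 0)
        + (if j.val + 1 = i.val then (if k ≤ j.val then b else 0) else 0) := by
    intro i j
    have hdist : Nat.dist i.val j.val = 1 ↔ i.val + 1 = j.val ∨ j.val + 1 = i.val := by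
      unfold Nat.dist
      omega
    rw [hA]
    simp only [Fin.ext_iff, hdist]
    have := i.isLt
    have := j.isLt
    split_ifs <;> first | omega | simp
  have card : ∀ m : ℕ, k ≤ m → (∑ i ∈ Finset.range m, if k ≤ i then (1 : ℝ) else 0) = m - k := by
    intro m hm
    induction m, hm using Nat.le_induction with
    | base =>
      rw [sub_self]
      exact Finset.sum_eq_zero fun i hi => if_neg (by simpa using hi)
    | succ m hm ih => rw [Finset.sum_range_succ, ih, if_pos hm]; push_cast; ring
  have card_mul : ∀ (m : ℕ) (c : ℝ), k ≤ m →
      (∑ i ∈ Finset.range m, if k ≤ i then c else 0) = (m - k) * c := by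
    intro m c hm
    rw [← card m hm, Finset.sum_mul]
    simp
  have shift : ∀ m : ℕ, (∑ i ∈ Finset.range (m + 1), ∑ j ∈ Finset.range (m + 1),
      if i + 1 = j then (if k ≤ i then b else 0) else 0) =
      ∑ i ∈ Finset.range m, if k ≤ i then b else 0 := by
    intro m
    simp only [Finset.sum_ite_eq, Finset.mem_range, Nat.add_lt_add_iff_right]
    rw [Finset.sum_range_succ, if_neg (lt_irrefl m), add_zero]
    exact Finset.sum_congr rfl fun i hi => if_pos (Finset.mem_range.mp hi)
  simp only [entry, Finset.sum_add_distrib]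
  obtain ⟨m, rfl⟩ : ∃ m, n = m + 1 := ⟨n - 1, by omega⟩
  rw [Finset.sum_comm (f := fun i j : Fin (m + 1) =>
    if j.val + 1 = i.val then (if k ≤ j.val then b else 0) else 0)]
  have toRange : ∀ f : ℕ → ℕ → ℝ, (∑ i : Fin (m + 1), ∑ j : Fin (m + 1), f i j) =
      ∑ i ∈ Finset.range (m + 1), ∑ j ∈ Finset.range (m + 1), f i j := by
    intro f
    simp only [Finset.sum_range]
  rw [toRange fun i j => if i + 1 = j then (if k ≤ i then b else 0) else 0, shift,
    card_mul m b (by omega),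
    toRange fun i j => if i = j then (if k ≤ i then a else 0) - (if i = 0 then
      (if k = 0 then r else 0) else 0) - (if i = m + 1 - 1 then r else 0) else 0]
  have diag : (∑ i ∈ Finset.range (m + 1), ∑ j ∈ Finset.range (m + 1),
      if i = j then (if k ≤ i then a else 0) - (if i = 0 then
        (if k = 0 then r else 0) else 0) - (if i = m + 1 - 1 then r else 0) else 0) =
      ((m + 1 : ℕ) - k) * a - (if k = 0 then r else 0) - r := by
    rw [← card_mul (m + 1) a hk.le]
    have : ∀ i ∈ Finset.range (m + 1), (∑ j ∈ Finset.range (m + 1),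
        if i = j then (if k ≤ i then a else 0) - (if i = 0 then
          (if k = 0 then r else 0) else 0) - (if i = m + 1 - 1 then r else 0) else 0) =
        (if k ≤ i then a else 0) - (if i = 0 then
          (if k = 0 then r else 0) else 0) - (if i = m then r else 0) := by
      intro i hi
      rw [Finset.sum_ite_eq, if_pos hi, Nat.add_sub_cancel]
    rw [Finset.sum_congr rfl this]
    simp only [Finset.sum_sub_distrib, Finset.sum_ite_eq']
    simp
  rw [diag]
  push_cast
  ring

/-- AR(1) case of Lemma 1: the normalized block sum of the inverse covariance
matrix converges to `((1-ρ)/σ)²`. -/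
theorem stmt_1 (ρ σ β : ℝ) (hρ : |ρ| < 1) (hσ : 0 < σ) (hβ : β ∈ Set.Ico (0 : ℝ) 1)
    (M : (n : ℕ) → Matrix (Fin n) (Fin n) ℝ)
    (hM : ∀ n : ℕ, 2 ≤ n → ∀ i j : Fin n, M n i j =
      if i = j then
        (if i.val = 0 ∨ i.val = n - 1 then 1 / σ ^ 2 else (1 + ρ ^ 2) / σ ^ 2)
      else if Nat.dist i.val j.val = 1 then -ρ / σ ^ 2 else 0) :
    Tendsto
      (fun n : ℕ =>
        (∑ i : Fin n, ∑ j : Fin n,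
          if Nat.floor ((n : ℝ) * β) ≤ i.val ∧ Nat.floor ((n : ℝ) * β) ≤ j.val
          then M n i j else 0) / ((n : ℝ) * (1 - β)))
      atTop (nhds (((1 - ρ) / σ) ^ 2)) := by
  obtain ⟨hβ0, hβ1⟩ := hβ
  have hβ' : 1 - β ≠ 0 := by linarith
  set r := ρ ^ 2 / σ ^ 2 with hr
  set b := -ρ / σ ^ 2 with hb
  have hfloor : Tendsto (fun n : ℕ => (⌊(n : ℝ) * β⌋₊ : ℝ) / n) atTop (nhds β) := by
    simpa only [mul_comm, Function.comp_def] using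
      (tendsto_nat_floor_mul_div_atTop hβ0).comp (tendsto_natCast_atTop_atTop (R := ℝ))
  have hboundary : Tendsto (fun n : ℕ =>
      ((if ⌊(n : ℝ) * β⌋₊ = 0 then r else 0) + r + 2 * b) * (1 / (n : ℝ))) atTop (nhds 0) := by
    refine bdd_le_mul_tendsto_zero' (|r| + |r| + |2 * b|) (Eventually.of_forall fun n => ?_)
      tendsto_one_div_atTop_nhds_zero_nat
    have hite : |if ⌊(n : ℝ) * β⌋₊ = 0 then r else 0| ≤ |r| := by
      split_ifs <;> simp
    exact (abs_add_three _ _ _).trans (by linarith)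
  have hlim := (((hfloor.const_sub 1).mul_const (((1 - ρ) / σ) ^ 2)).sub hboundary).div_const
    (1 - β)
  rw [sub_zero, mul_div_cancel_left₀ _ hβ'] at hlim
  refine hlim.congr' ?_
  filter_upwards [eventually_ge_atTop 2] with n hn
  have hn0 : (0 : ℝ) < n := by positivity
  have hk : ⌊(n : ℝ) * β⌋₊ < n := by
    rw [Nat.floor_lt (by positivity)]
    nlinarith
  rw [sum_trailing_block_tridiagonal ((1 + ρ ^ 2) / σ ^ 2) b r hn hk (M n) fun i j => by
    rw [hM n hn, hr, ← sub_div, add_sub_cancel_right]]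
  have hc : (1 + ρ ^ 2) / σ ^ 2 + 2 * b = ((1 - ρ) / σ) ^ 2 := by
    rw [hb]
    field_simp
    ring
  rw [hc]
  field_simp
end

section
/- Let n ≥ 1, let Σ and T be positive definite n×n real matrices, let ν ∈ ℝⁿ, and let θ ∈ ℝ be such that the matrix M := θT⁻¹ + (1−θ)Σ⁻¹ is positive definite. Define f(x) = (2π)^{−n/2}(det Σ)^{−1/2} exp(−½ xᵀΣ⁻¹x) and g(x) = (2π)^{−n/2}(det T)^{−1/2} exp(−½ (x−ν)ᵀT⁻¹(x−ν)). Then ∫_{ℝⁿ} g(x)^θ f(x)^{1−θ} dx = (det Σ/det T)^{θ/2} · det(θT⁻¹Σ + (1−θ)I_n)^{−1/2} · exp( −(θ/2)·νᵀT⁻¹ν + (θ²/2)·νᵀT⁻¹ M⁻¹ T⁻¹ν ). -/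
open Real MeasureTheory Matrix

open scoped MatrixOrder in
/-- The Gaussian integral of a positive definite quadratic form. -/
theorem integral_exp_neg_half_quadraticForm {ι : Type*} [Fintype ι] [DecidableEq ι]
    {M : Matrix ι ι ℝ} (hM : M.PosDef) :
    ∫ x : ι → ℝ, Real.exp (-(1 / 2) * (x ⬝ᵥ M *ᵥ x)) =
      (2 * π) ^ ((Fintype.card ι : ℝ) / 2) * M.det ^ (-(1 : ℝ) / 2) := by
  obtain ⟨B, hB⟩ := CStarAlgebra.nonneg_iff_eq_star_mul_self.mp hM.posSemidef.nonneg
  rw [star_eq_conjTranspose, conjTranspose_eq_transpose_of_trivial] at hB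
  have hdet : M.det = B.det ^ 2 := by rw [hB, det_mul, det_transpose, sq]
  have hB0 : B.det ≠ 0 := fun h => hM.det_pos.ne' (by simp [hdet, h])
  have hquad (x : ι → ℝ) : x ⬝ᵥ M *ᵥ x = ∑ i, toLin' B x i ^ 2 := by
    rw [hB, ← mulVec_mulVec, dotProduct_mulVec, vecMul_transpose, toLin'_apply]
    simp [dotProduct, sq]
  have hgauss : ∫ y : ι → ℝ, Real.exp (-(1 / 2) * ∑ i, y i ^ 2) =
      (2 * π) ^ ((Fintype.card ι : ℝ) / 2) := by
    simp_rw [Finset.mul_sum, Real.exp_sum]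
    rw [integral_fintype_prod_volume_eq_pow fun t : ℝ => Real.exp (-(1 / 2) * t ^ 2),
      integral_gaussian, Real.sqrt_eq_rpow, ← Real.rpow_natCast, ← Real.rpow_mul (by positivity)]
    congr 1 <;> ring
  simp_rw [hquad]
  rw [← integral_map (f := fun y : ι → ℝ => Real.exp (-(1 / 2) * ∑ i, y i ^ 2))
      (toLin' B).continuous_of_finiteDimensional.aemeasurable
      (Continuous.aestronglyMeasurable (by fun_prop)),
    Real.map_matrix_volume_pi_eq_smul_volume_pi hB0, integral_smul_measure,
    hgauss, ENNReal.toReal_ofReal (abs_nonneg _), smul_eq_mul, mul_comm, hdet, neg_div,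
    Real.rpow_neg (sq_nonneg _), ← Real.sqrt_eq_rpow, Real.sqrt_sq_eq_abs, abs_inv]

/-- Completing the square in a weighted sum of two quadratic forms. -/
theorem weighted_quadraticForm_eq_complete_square {ι : Type*} [Fintype ι] [DecidableEq ι]
    {P Q : Matrix ι ι ℝ} (hP : P.IsSymm) (hQ : Q.IsSymm) (a b : ℝ)
    (hdet : IsUnit (a • P + b • Q).det) (ν x : ι → ℝ) :
    a * ((x - ν) ⬝ᵥ P *ᵥ (x - ν)) + b * (x ⬝ᵥ Q *ᵥ x) =
      (x - (a • P + b • Q)⁻¹ *ᵥ (a • P *ᵥ ν)) ⬝ᵥ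
          (a • P + b • Q) *ᵥ (x - (a • P + b • Q)⁻¹ *ᵥ (a • P *ᵥ ν)) +
        a * (ν ⬝ᵥ P *ᵥ ν) - a ^ 2 * (ν ⬝ᵥ (P * (a • P + b • Q)⁻¹ * P) *ᵥ ν) := by
  set M := a • P + b • Q with hMdef
  have hMs : M.IsSymm := (hP.smul a).add (hQ.smul b)
  have symm {A : Matrix ι ι ℝ} (hA : A.IsSymm) (u v : ι → ℝ) : u ⬝ᵥ A *ᵥ v = v ⬝ᵥ A *ᵥ u := by
    rw [dotProduct_mulVec, ← mulVec_transpose, hA.eq, dotProduct_comm]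
  have hx : x ⬝ᵥ M *ᵥ x = a * (x ⬝ᵥ P *ᵥ x) + b * (x ⬝ᵥ Q *ᵥ x) := by
    simp [hMdef, add_mulVec, smul_mulVec]
  set m := M⁻¹ *ᵥ (a • P *ᵥ ν) with hm
  have hMm : M *ᵥ m = a • P *ᵥ ν := by
    rw [hm, mulVec_mulVec, mul_nonsing_inv _ hdet, one_mulVec]
  have hmm : m ⬝ᵥ M *ᵥ m = a ^ 2 * (ν ⬝ᵥ (P * M⁻¹ * P) *ᵥ ν) := by
    rw [hMm, dotProduct_smul, symm hP, hm, mulVec_smul, mulVec_smul, dotProduct_smul,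
      mulVec_mulVec, mulVec_mulVec, smul_eq_mul, smul_eq_mul, Matrix.mul_assoc]
    ring
  have hxm : x ⬝ᵥ M *ᵥ m = a * (x ⬝ᵥ P *ᵥ ν) := by
    rw [hMm, dotProduct_smul, smul_eq_mul]
  simp only [mulVec_sub, sub_dotProduct, dotProduct_sub]
  rw [symm hMs m x, hmm, hxm, hx, symm hP ν x]
  ring

/-- Moment generating function of the multivariate Gaussian log-likelihood
ratio: `∫ g^θ f^(1-θ)` for `f` the density of `N(0,Σ)` and `g` that of
`N(ν,T)`, with `M = θT⁻¹ + (1-θ)Σ⁻¹` positive definite. -/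
theorem stmt_4 (n : ℕ) (hn : 1 ≤ n) (S T : Matrix (Fin n) (Fin n) ℝ)
    (hS : S.PosDef) (hT : T.PosDef) (ν : Fin n → ℝ) (θ : ℝ)
    (hM : (θ • T⁻¹ + (1 - θ) • S⁻¹).PosDef)
    (f g : (Fin n → ℝ) → ℝ)
    (hf : ∀ x, f x = (2 * π) ^ (-(n : ℝ) / 2) * S.det ^ (-(1 : ℝ) / 2) *
      Real.exp (-(1 / 2) * (x ⬝ᵥ S⁻¹ *ᵥ x)))
    (hg : ∀ x, g x = (2 * π) ^ (-(n : ℝ) / 2) * T.det ^ (-(1 : ℝ) / 2) *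
      Real.exp (-(1 / 2) * ((x - ν) ⬝ᵥ T⁻¹ *ᵥ (x - ν)))) :
    ∫ x : Fin n → ℝ, g x ^ θ * f x ^ (1 - θ) =
      (S.det / T.det) ^ (θ / 2) *
        (θ • (T⁻¹ * S) + (1 - θ) • (1 : Matrix (Fin n) (Fin n) ℝ)).det ^ (-(1 : ℝ) / 2) *
        Real.exp (-(θ / 2) * (ν ⬝ᵥ T⁻¹ *ᵥ ν) +
          (θ ^ 2 / 2) * (ν ⬝ᵥ (T⁻¹ * (θ • T⁻¹ + (1 - θ) • S⁻¹)⁻¹ * T⁻¹) *ᵥ ν)) := by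
  set M := θ • T⁻¹ + (1 - θ) • S⁻¹ with hMdef
  have hSd := hS.det_pos
  have hTd := hT.det_pos
  have hMd := hM.det_pos
  have h2π : (0 : ℝ) < 2 * π := by positivity
  set m := M⁻¹ *ᵥ (θ • T⁻¹ *ᵥ ν) with hm
  set K := -(θ / 2) * (ν ⬝ᵥ T⁻¹ *ᵥ ν) + (θ ^ 2 / 2) * (ν ⬝ᵥ (T⁻¹ * M⁻¹ * T⁻¹) *ᵥ ν) with hK
  have hdet : (θ • (T⁻¹ * S) + (1 - θ) • (1 : Matrix (Fin n) (Fin n) ℝ)).det =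
      M.det * S.det := by
    rw [← det_mul, hMdef, Matrix.add_mul, smul_mul_assoc, smul_mul_assoc,
      nonsing_inv_mul _ hSd.ne'.isUnit]
  have hpt (x : Fin n → ℝ) : g x ^ θ * f x ^ (1 - θ) =
      (2 * π) ^ (-(n : ℝ) / 2) * T.det ^ (-θ / 2) * S.det ^ (-(1 - θ) / 2) * Real.exp K *
        Real.exp (-(1 / 2) * ((x - m) ⬝ᵥ M *ᵥ (x - m))) := by
    have hsq := weighted_quadraticForm_eq_complete_square
      ((conjTranspose_eq_transpose_of_trivial _).symm.trans hT.inv.isHermitian)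
      ((conjTranspose_eq_transpose_of_trivial _).symm.trans hS.inv.isHermitian)
      θ (1 - θ) hMd.ne'.isUnit ν x
    rw [← hMdef, ← hm] at hsq
    rw [hg, hf]
    simp only [Real.rpow_def_of_pos h2π, Real.rpow_def_of_pos hTd, Real.rpow_def_of_pos hSd,
      ← Real.exp_add, ← Real.exp_mul]
    congr 1
    rw [hK]
    linear_combination (-(1 / 2) : ℝ) * hsq
  simp_rw [hpt]
  rw [integral_const_mul,
    integral_sub_right_eq_self (fun x : Fin n → ℝ => Real.exp (-(1 / 2) * (x ⬝ᵥ M *ᵥ x))) m,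
    integral_exp_neg_half_quadraticForm hM, hdet, Fintype.card_fin,
    Real.rpow_def_of_pos (div_pos hSd hTd), Real.rpow_def_of_pos (mul_pos hMd hSd),
    Real.log_div hSd.ne' hTd.ne', Real.log_mul hMd.ne' hSd.ne']
  simp only [Real.rpow_def_of_pos h2π, Real.rpow_def_of_pos hTd, Real.rpow_def_of_pos hSd,
    Real.rpow_def_of_pos hMd, ← Real.exp_add]
  congr 1
  ring
end

section
/- Let n ≥ 1, let T be a positive definite n×n real matrix, let ν ∈ ℝⁿ, and let θ ∈ ℝ. Define f(x) = (2π)^{−n/2}(det T)^{−1/2} exp(−½ xᵀT⁻¹x) and g(x) = (2π)^{−n/2}(det T)^{−1/2} exp(−½ (x−ν)ᵀT⁻¹(x−ν)). Then ∫_{ℝⁿ} g(x)^θ f(x)^{1−θ} dx = exp( −(θ/2)·νᵀT⁻¹ν + (θ²/2)·νᵀT⁻¹ν ). -/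
open Real MeasureTheory Matrix

lemma integral_comp_mulVec {ι E : Type*} [Fintype ι] [DecidableEq ι] [NormedAddCommGroup E]
    [NormedSpace ℝ E] {M : Matrix ι ι ℝ} (hM : M.det ≠ 0) {f : (ι → ℝ) → E} (hf : Continuous f) :
    ∫ x, f (M *ᵥ x) = |M.det|⁻¹ • ∫ x, f x := by
  have hcont : Continuous (toLin' M) := LinearMap.continuous_of_finiteDimensional _
  have h := integral_map (μ := (volume : Measure (ι → ℝ))) (φ := toLin' M) hcont.aemeasurable
    (f := f) hf.aestronglyMeasurable
  rw [Real.map_matrix_volume_pi_eq_smul_volume_pi hM, integral_smul_measure,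
    ENNReal.toReal_ofReal (abs_nonneg _), abs_inv] at h
  simpa only [toLin'_apply] using h.symm

lemma integral_exp_neg_half_dotProduct_self (ι : Type*) [Fintype ι] :
    ∫ x : ι → ℝ, Real.exp (-(1 / 2) * (x ⬝ᵥ x)) = (2 * π) ^ ((Fintype.card ι : ℝ) / 2) := by
  have h (x : ι → ℝ) : Real.exp (-(1 / 2) * (x ⬝ᵥ x)) =
      ∏ i, Real.exp (-(1 / 2) * x i ^ 2) := by
    rw [← Real.exp_sum, dotProduct, Finset.mul_sum]
    simp only [sq]
  simp_rw [h]
  rw [integral_fintype_prod_volume_eq_pow (fun t : ℝ => Real.exp (-(1 / 2) * t ^ 2)),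
    integral_gaussian, show π / (1 / 2) = 2 * π by ring, Real.sqrt_eq_rpow, ← Real.rpow_natCast,
    ← Real.rpow_mul (by positivity)]
  congr 1
  ring

open scoped MatrixOrder in
lemma Matrix.PosDef.integral_exp_neg_half {ι : Type*} [Fintype ι] [DecidableEq ι]
    {Q : Matrix ι ι ℝ} (hQ : Q.PosDef) :
    ∫ x : ι → ℝ, Real.exp (-(1 / 2) * (x ⬝ᵥ Q *ᵥ x)) =
      (2 * π) ^ ((Fintype.card ι : ℝ) / 2) * Q.det ^ (-(1 : ℝ) / 2) := by
  have hdet := hQ.det_pos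
  obtain ⟨B, rfl⟩ := CStarAlgebra.nonneg_iff_eq_star_mul_self.mp hQ.posSemidef.nonneg
  rw [star_eq_conjTranspose, conjTranspose_eq_transpose_of_trivial] at hdet ⊢
  rw [det_mul, det_transpose] at hdet ⊢
  have hB : B.det ≠ 0 := fun h => by simp [h] at hdet
  have h (x : ι → ℝ) : x ⬝ᵥ (Bᵀ * B) *ᵥ x = (B *ᵥ x) ⬝ᵥ (B *ᵥ x) := by
    rw [← mulVec_mulVec, dotProduct_mulVec, vecMul_transpose]
  simp_rw [h]
  rw [integral_comp_mulVec hB (f := fun y => Real.exp (-(1 / 2) * (y ⬝ᵥ y)))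
    (by unfold dotProduct; fun_prop), integral_exp_neg_half_dotProduct_self, smul_eq_mul, mul_comm,
    neg_div, Real.rpow_neg hdet.le, ← Real.sqrt_eq_rpow, Real.sqrt_mul_self_eq_abs]

lemma Matrix.IsSymm.quadratic_interpolation {ι : Type*} [Fintype ι] {Q : Matrix ι ι ℝ}
    (hQ : Q.IsSymm) (x v : ι → ℝ) (t : ℝ) :
    t * ((x - v) ⬝ᵥ Q *ᵥ (x - v)) + (1 - t) * (x ⬝ᵥ Q *ᵥ x) =
      (x - t • v) ⬝ᵥ Q *ᵥ (x - t • v) + (t - t ^ 2) * (v ⬝ᵥ Q *ᵥ v) := by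
  have h : v ⬝ᵥ Q *ᵥ x = x ⬝ᵥ Q *ᵥ v := by
    rw [dotProduct_comm, ← vecMul_transpose, hQ.eq, dotProduct_mulVec]
  simp only [mulVec_sub, mulVec_smul, sub_dotProduct, dotProduct_sub, smul_dotProduct,
    dotProduct_smul, smul_eq_mul, h]
  ring

/-- Moment generating function of the multivariate Gaussian log-likelihood
ratio when only the mean changes (common covariance `T`). -/
theorem stmt_5 (n : ℕ) (hn : 1 ≤ n) (T : Matrix (Fin n) (Fin n) ℝ)
    (hT : T.PosDef) (ν : Fin n → ℝ) (θ : ℝ)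
    (f g : (Fin n → ℝ) → ℝ)
    (hf : ∀ x, f x = (2 * π) ^ (-(n : ℝ) / 2) * T.det ^ (-(1 : ℝ) / 2) *
      Real.exp (-(1 / 2) * (x ⬝ᵥ T⁻¹ *ᵥ x)))
    (hg : ∀ x, g x = (2 * π) ^ (-(n : ℝ) / 2) * T.det ^ (-(1 : ℝ) / 2) *
      Real.exp (-(1 / 2) * ((x - ν) ⬝ᵥ T⁻¹ *ᵥ (x - ν)))) :
    ∫ x : Fin n → ℝ, g x ^ θ * f x ^ (1 - θ) =
      Real.exp (-(θ / 2) * (ν ⬝ᵥ T⁻¹ *ᵥ ν) + (θ ^ 2 / 2) * (ν ⬝ᵥ T⁻¹ *ᵥ ν)) := by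
  have hdet := hT.det_pos
  have hsymm : T⁻¹.IsSymm := by
    simpa [IsHermitian, IsSymm] using hT.inv.isHermitian
  set c : ℝ := (2 * π) ^ (-(n : ℝ) / 2) * T.det ^ (-(1 : ℝ) / 2) with hc
  have hc0 : 0 < c := by positivity
  set K := Real.exp (-(θ / 2) * (ν ⬝ᵥ T⁻¹ *ᵥ ν) + (θ ^ 2 / 2) * (ν ⬝ᵥ T⁻¹ *ᵥ ν)) with hK
  have key (x : Fin n → ℝ) : g x ^ θ * f x ^ (1 - θ) =
      K * c * Real.exp (-(1 / 2) * ((x - θ • ν) ⬝ᵥ T⁻¹ *ᵥ (x - θ • ν))) := by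
    have hq := hsymm.quadratic_interpolation x ν θ
    rw [hg, hf, Real.mul_rpow hc0.le (Real.exp_pos _).le, Real.mul_rpow hc0.le (Real.exp_pos _).le,
      ← Real.exp_mul, ← Real.exp_mul, mul_mul_mul_comm, ← Real.rpow_add hc0, ← Real.exp_add,
      add_sub_cancel, Real.rpow_one, mul_comm K c, mul_assoc c, hK, ← Real.exp_add]
    congr 2
    linear_combination (-(1 / 2)) * hq
  have hnorm : c * ((2 * π) ^ ((n : ℝ) / 2) * T⁻¹.det ^ (-(1 : ℝ) / 2)) = 1 := by
    rw [hc, det_nonsing_inv, Ring.inverse_eq_inv', Real.inv_rpow hdet.le, neg_div, neg_div,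
      Real.rpow_neg (by positivity)]
    field_simp
  simp_rw [key]
  rw [integral_const_mul, integral_sub_right_eq_self
    (fun x : Fin n → ℝ => Real.exp (-(1 / 2) * (x ⬝ᵥ T⁻¹ *ᵥ x))), hT.inv.integral_exp_neg_half,
    Fintype.card_fin, mul_assoc, hnorm, mul_one]
end

section
/- Let σ, τ > 0 with σ ≠ τ, let β ∈ [0,1), let b ∈ ℝ, and set c := b/(1−β) − log(σ/τ). Assume (σ² − τ²)·c < 0. Then sup over all θ ∈ ℝ with θσ² + (1−θ)τ² > 0 of the quantity ( θb − θ(1−β)log(σ/τ) − ½(1−β)log τ² + ½(1−β)log(θσ² + (1−θ)τ²) ) equals (1−β)·( −½ − (τ²/(σ²−τ²))·c − ½·log( −2τ²·c/(σ²−τ²) ) ), and the supremum is attained at θ* = −(½(1−β))/(b − (1−β)log(σ/τ)) − τ²/(σ²−τ²). -/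
open Real

/-- The tangent line of `log` at `s` lies above its graph. -/
theorem log_le_log_add_div_sub_one {s v : ℝ} (hs : 0 < s) (hv : 0 < v) :
    Real.log v ≤ Real.log s + (v / s - 1) := by
  have h := Real.log_le_sub_one_of_pos (div_pos hv hs)
  rw [Real.log_div hv.ne' hs.ne'] at h
  linarith

/-- Legendre transform of the limiting log-moment generating function for the
change-of-variance test: value of the supremum and its optimizer. -/
theorem stmt_8 (σ τ β b : ℝ) (hσ : 0 < σ) (hτ : 0 < τ) (hστ : σ ≠ τ)
    (hβ : β ∈ Set.Ico (0 : ℝ) 1)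
    (c : ℝ) (hc : c = b / (1 - β) - Real.log (σ / τ))
    (hneg : (σ ^ 2 - τ ^ 2) * c < 0) :
    IsGreatest
      {y : ℝ | ∃ θ : ℝ, 0 < θ * σ ^ 2 + (1 - θ) * τ ^ 2 ∧
        y = θ * b - θ * (1 - β) * Real.log (σ / τ) - (1 / 2) * (1 - β) * Real.log (τ ^ 2)
            + (1 / 2) * (1 - β) * Real.log (θ * σ ^ 2 + (1 - θ) * τ ^ 2)}
      ((1 - β) * (-(1 / 2) - τ ^ 2 / (σ ^ 2 - τ ^ 2) * c
        - (1 / 2) * Real.log (-2 * τ ^ 2 * c / (σ ^ 2 - τ ^ 2)))) ∧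
    (let θs : ℝ := -((1 / 2) * (1 - β)) / (b - (1 - β) * Real.log (σ / τ))
        - τ ^ 2 / (σ ^ 2 - τ ^ 2);
      0 < θs * σ ^ 2 + (1 - θs) * τ ^ 2 ∧
      θs * b - θs * (1 - β) * Real.log (σ / τ) - (1 / 2) * (1 - β) * Real.log (τ ^ 2)
          + (1 / 2) * (1 - β) * Real.log (θs * σ ^ 2 + (1 - θs) * τ ^ 2)
        = (1 - β) * (-(1 / 2) - τ ^ 2 / (σ ^ 2 - τ ^ 2) * c
          - (1 / 2) * Real.log (-2 * τ ^ 2 * c / (σ ^ 2 - τ ^ 2)))) := by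
  have hk : 0 < 1 - β := sub_pos.mpr hβ.2
  have hk' := hk.ne'
  have hc0 : c ≠ 0 := right_ne_zero_of_mul hneg.ne
  have hD : σ ^ 2 - τ ^ 2 ≠ 0 := left_ne_zero_of_mul hneg.ne
  have hb : b = (1 - β) * (c + Real.log (σ / τ)) := by
    rw [hc]
    field_simp
    ring
  have hs : 0 < -(σ ^ 2 - τ ^ 2) / (2 * c) := by
    have h : -(σ ^ 2 - τ ^ 2) / (2 * c) = -((σ ^ 2 - τ ^ 2) * c) / (2 * c ^ 2) := by
      field_simp
    rw [h]
    exact div_pos (neg_pos.mpr hneg) (by positivity)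
  have hlog : Real.log (-2 * τ ^ 2 * c / (σ ^ 2 - τ ^ 2))
      = Real.log (τ ^ 2) - Real.log (-(σ ^ 2 - τ ^ 2) / (2 * c)) := by
    rw [← Real.log_div (by positivity) hs.ne']
    congr 1
    field_simp
  have hopt : -((1 / 2) * (1 - β)) / (b - (1 - β) * Real.log (σ / τ))
      = -1 / (2 * c) := by
    have h : b - (1 - β) * Real.log (σ / τ) = (1 - β) * c := by rw [hb]; ring
    rw [h]
    field_simp
  have harg : (-1 / (2 * c) - τ ^ 2 / (σ ^ 2 - τ ^ 2)) * σ ^ 2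
      + (1 - (-1 / (2 * c) - τ ^ 2 / (σ ^ 2 - τ ^ 2))) * τ ^ 2
      = -(σ ^ 2 - τ ^ 2) / (2 * c) := by
    field_simp
    ring
  rw [hlog, hopt]
  have hval : (-1 / (2 * c) - τ ^ 2 / (σ ^ 2 - τ ^ 2)) * c
      = -(1 / 2) - τ ^ 2 / (σ ^ 2 - τ ^ 2) * c := by
    field_simp
  rw [← hval]
  refine and_comm.mp ⟨⟨by rwa [harg], by rw [harg, hb]; ring⟩,
    ⟨_, by rwa [harg], by rw [harg, hb]; ring⟩, ?_⟩
  rintro y ⟨θ, hθ, rfl⟩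
  have htangent := mul_le_mul_of_nonneg_left (log_le_log_add_div_sub_one hs hθ) hk.le
  have hratio : (θ * σ ^ 2 + (1 - θ) * τ ^ 2) / (-(σ ^ 2 - τ ^ 2) / (2 * c)) - 1
      = 2 * ((-1 / (2 * c) - τ ^ 2 / (σ ^ 2 - τ ^ 2)) * c) - 2 * (θ * c) := by
    field_simp
    ring
  rw [hratio] at htangent
  rw [hb]
  linarith
end

section
/- Let f > 0 with f ≠ 1, let m > 0 be a real number, let b ∈ ℝ, and set d := b/m + log f. Assume (1/f² − 1)·d < 0. Then sup over all θ ∈ ℝ with θ/f² + (1−θ) > 0 of the quantity ( θb + θ·m·log f + (m/2)·log(θ/f² + (1−θ)) ) equals m·( −½ − d/(1/f² − 1) − ½·log( −2d/(1/f² − 1) ) ), and the supremum is attained at θ* = −( (m/2)/(b + m·log f) + 1/(1/f² − 1) ). -/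
open Real

/-- The tilted objective `θ d + log (1 + θ c) / 2` is bounded by its value at the critical point. -/
lemma mul_add_half_log_le {c d θ : ℝ} (h : c * d < 0) (hθ : 0 < 1 + θ * c) :
    θ * d + 1 / 2 * Real.log (1 + θ * c)
      ≤ -(1 / 2) - d / c - 1 / 2 * Real.log (-2 * d / c) := by
  have hc : c ≠ 0 := left_ne_zero_of_mul h.ne
  have hp : 0 < -2 * d / c := by
    rw [show -2 * d / c = -2 * (c * d) / c ^ 2 by field_simp]
    have : 0 < -2 * (c * d) := by linarith
    positivity
  have hlog := Real.log_le_sub_one_of_pos (mul_pos hθ hp)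
  rw [Real.log_mul hθ.ne' hp.ne'] at hlog
  have hmul : (1 + θ * c) * (-2 * d / c) = -2 * (d / c) - 2 * (θ * d) := by
    field_simp
    ring
  linarith

/-- The bound of `mul_add_half_log_le` is attained at `θ = -(1 / (2 d) + 1 / c)`. -/
lemma mul_add_half_log_eq {c d : ℝ} (h : c * d < 0) :
    -(1 / (2 * d) + 1 / c) * d + 1 / 2 * Real.log (1 + -(1 / (2 * d) + 1 / c) * c)
      = -(1 / 2) - d / c - 1 / 2 * Real.log (-2 * d / c) := by
  have hc : c ≠ 0 := left_ne_zero_of_mul h.ne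
  have hd : d ≠ 0 := right_ne_zero_of_mul h.ne
  have hinv : 1 + -(1 / (2 * d) + 1 / c) * c = (-2 * d / c)⁻¹ := by
    field_simp
    ring
  rw [hinv, Real.log_inv]
  field_simp
  ring

/-- Legendre transform of the limiting log-moment generating function for the
change-of-scale test: value of the supremum and its optimizer. -/
theorem stmt_9 (f m b : ℝ) (hf : 0 < f) (hf1 : f ≠ 1) (hm : 0 < m)
    (d : ℝ) (hd : d = b / m + Real.log f)
    (hneg : (1 / f ^ 2 - 1) * d < 0) :
    IsGreatest
      {y : ℝ | ∃ θ : ℝ, 0 < θ / f ^ 2 + (1 - θ) ∧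
        y = θ * b + θ * m * Real.log f + (m / 2) * Real.log (θ / f ^ 2 + (1 - θ))}
      (m * (-(1 / 2) - d / (1 / f ^ 2 - 1)
        - (1 / 2) * Real.log (-2 * d / (1 / f ^ 2 - 1)))) ∧
    (let θs : ℝ := -((m / 2) / (b + m * Real.log f) + 1 / (1 / f ^ 2 - 1));
      0 < θs / f ^ 2 + (1 - θs) ∧
      θs * b + θs * m * Real.log f + (m / 2) * Real.log (θs / f ^ 2 + (1 - θs))
        = m * (-(1 / 2) - d / (1 / f ^ 2 - 1)
          - (1 / 2) * Real.log (-2 * d / (1 / f ^ 2 - 1)))) := by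
  have hden (θ : ℝ) : θ / f ^ 2 + (1 - θ) = 1 + θ * (1 / f ^ 2 - 1) := by ring
  have hmd : b + m * Real.log f = m * d := by
    rw [hd]
    field_simp
  have hobj (θ L : ℝ) :
      θ * b + θ * m * Real.log f + m / 2 * L = m * (θ * d + 1 / 2 * L) := by
    linear_combination θ * hmd
  simp only [hden, hobj, hmd]
  generalize 1 / f ^ 2 - 1 = c at hneg ⊢
  have hc : c ≠ 0 := left_ne_zero_of_mul hneg.ne
  have hd0 : d ≠ 0 := right_ne_zero_of_mul hneg.ne
  have hθs : m / 2 / (m * d) = 1 / (2 * d) := by field_simp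
  have hpos : 0 < 1 + -(1 / (2 * d) + 1 / c) * c := by
    have h : 1 + -(1 / (2 * d) + 1 / c) * c = -(c * d) / (2 * d ^ 2) := by
      field_simp
      ring
    rw [h]
    have : 0 < -(c * d) := by linarith
    positivity
  have heq := congrArg (m * ·) (mul_add_half_log_eq hneg)
  rw [hθs]
  refine ⟨⟨⟨_, hpos, heq.symm⟩, ?_⟩, hpos, heq⟩
  rintro y ⟨θ, hθ, rfl⟩
  exact mul_le_mul_of_nonneg_left (mul_add_half_log_le hneg hθ) hm.le
end

section
/- Let m ≥ 1, let Σ be a positive definite m×m real matrix, let f > 0, let ν̄ ∈ ℝ, and let θ ∈ ℝ satisfy θ/f² + (1−θ) > 0. Let 𝟙 ∈ ℝᵐ be the all-ones vector and s := 𝟙ᵀΣ⁻¹𝟙 (the sum of all entries of Σ⁻¹). Define p(x) = (2π)^{−m/2}(det Σ)^{−1/2} exp(−½ xᵀΣ⁻¹x) and q(x) = (2π)^{−m/2}(det(f²Σ))^{−1/2} exp(−½ (x−ν̄𝟙)ᵀ(f²Σ)⁻¹(x−ν̄𝟙)). Then ∫_{ℝᵐ} q(x)^θ p(x)^{1−θ}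 dx = f^{−θm} · (θ/f² + (1−θ))^{−m/2} · exp( −θ·s·ν̄²/(2f²) + θ²·s·ν̄²/(2(θf² + (1−θ)f⁴)) ). -/
open Real MeasureTheory Matrix

/-- The centred Gaussian integral attached to a positive definite quadratic form. -/
theorem integral_exp_neg_mul_dotProduct_mulVec {ι : Type*} [Fintype ι] [DecidableEq ι]
    {A : Matrix ι ι ℝ} (hA : A.PosDef) {b : ℝ} (hb : 0 < b) :
    ∫ x : ι → ℝ, Real.exp (-b * (x ⬝ᵥ A *ᵥ x)) =
      (π / b) ^ ((Fintype.card ι : ℝ) / 2) * A.det ^ (-(1 : ℝ) / 2) := by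
  obtain ⟨B, hB⟩ : ∃ B : Matrix ι ι ℝ, A = Bᵀ * B := by
    open scoped MatrixOrder Matrix.Norms.L2Operator in
    obtain ⟨B, -, hB⟩ := CStarAlgebra.isStrictlyPositive_iff_eq_star_mul_self.mp
      (isStrictlyPositive_iff_posDef.mpr hA)
    exact ⟨B, by rw [hB, star_eq_conjTranspose, conjTranspose_eq_transpose_of_trivial]⟩
  have hdetA : A.det = |B.det| ^ 2 := by
    rw [hB, det_mul, det_transpose, sq_abs, sq]
  have hdetB : B.det ≠ 0 := by
    intro h
    simpa [hdetA, h] using hA.det_pos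
  have hquad (x : ι → ℝ) : Real.exp (-b * (x ⬝ᵥ A *ᵥ x)) =
      (fun y : ι → ℝ ↦ ∏ i, Real.exp (-b * y i ^ 2)) (toLin' B x) := by
    have h : x ⬝ᵥ A *ᵥ x = B *ᵥ x ⬝ᵥ B *ᵥ x := by
      rw [hB, ← mulVec_mulVec, dotProduct_mulVec, vecMul_transpose]
    rw [h]
    simp only [← Real.exp_sum, ← Finset.mul_sum, toLin'_apply, dotProduct, sq]
  have hcont : Continuous fun y : ι → ℝ ↦ ∏ i, Real.exp (-b * y i ^ 2) := by fun_prop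
  simp_rw [hquad]
  rw [← integral_map (LinearMap.continuous_of_finiteDimensional _).aemeasurable
      hcont.aestronglyMeasurable,
    Real.map_matrix_volume_pi_eq_smul_volume_pi hdetB, integral_smul_measure,
    integral_fintype_prod_volume_eq_pow fun t : ℝ ↦ Real.exp (-b * t ^ 2), integral_gaussian,
    ENNReal.toReal_ofReal (abs_nonneg _), smul_eq_mul, mul_comm, hdetA, abs_inv]
  have hdetB' : 0 < |B.det| := abs_pos.mpr hdetB
  congr 1
  · rw [Real.sqrt_eq_rpow, ← Real.rpow_natCast, ← Real.rpow_mul (by positivity)]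
    congr 1
    ring
  · rw [← Real.rpow_natCast, ← Real.rpow_mul hdetB'.le, ← Real.rpow_neg_one]
    norm_num

/-- Completing the square in an affine combination of a shifted and a centred quadratic form. -/
theorem add_dotProduct_mulVec_sub_eq {ι : Type*} [Fintype ι] {A : Matrix ι ι ℝ}
    (hA : A.IsSymm) {a b : ℝ} (hab : a + b ≠ 0) (u x : ι → ℝ) :
    a * ((x - u) ⬝ᵥ A *ᵥ (x - u)) + b * (x ⬝ᵥ A *ᵥ x) =
      (a + b) * ((x - (a / (a + b)) • u) ⬝ᵥ A *ᵥ (x - (a / (a + b)) • u)) +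
        (a - a ^ 2 / (a + b)) * (u ⬝ᵥ A *ᵥ u) := by
  have hux : u ⬝ᵥ A *ᵥ x = x ⬝ᵥ A *ᵥ u := by
    rw [dotProduct_mulVec, ← mulVec_transpose, hA.eq, dotProduct_comm]
  simp only [mulVec_sub, mulVec_smul, sub_dotProduct, dotProduct_sub, smul_dotProduct,
    dotProduct_smul, smul_eq_mul, hux]
  field_simp
  ring

/-- Moment generating function of the post-change log-likelihood ratio for the
change-of-scale alternative `N(ν̄𝟙, f²Σ)` against the null `N(0, Σ)`. -/
theorem stmt_10 (m : ℕ) (hm : 1 ≤ m) (S : Matrix (Fin m) (Fin m) ℝ) (hS : S.PosDef)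
    (f ν θ : ℝ) (hf : 0 < f) (hθ : 0 < θ / f ^ 2 + (1 - θ))
    (s : ℝ) (hs : s = (fun _ => (1 : ℝ)) ⬝ᵥ S⁻¹ *ᵥ (fun _ => (1 : ℝ)))
    (p q : (Fin m → ℝ) → ℝ)
    (hp : ∀ x, p x = (2 * π) ^ (-(m : ℝ) / 2) * S.det ^ (-(1 : ℝ) / 2) *
      Real.exp (-(1 / 2) * (x ⬝ᵥ S⁻¹ *ᵥ x)))
    (hq : ∀ x, q x = (2 * π) ^ (-(m : ℝ) / 2) * (f ^ 2 • S).det ^ (-(1 : ℝ) / 2) *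
      Real.exp (-(1 / 2) *
        ((x - fun _ => ν) ⬝ᵥ (f ^ 2 • S)⁻¹ *ᵥ (x - fun _ => ν)))) :
    ∫ x : Fin m → ℝ, q x ^ θ * p x ^ (1 - θ) =
      f ^ (-(θ * (m : ℝ))) * (θ / f ^ 2 + (1 - θ)) ^ (-(m : ℝ) / 2) *
        Real.exp (-(θ * s * ν ^ 2) / (2 * f ^ 2) +
          θ ^ 2 * s * ν ^ 2 / (2 * (θ * f ^ 2 + (1 - θ) * f ^ 4))) := by
  have hdet : 0 < S.det := hS.det_pos
  have hc : θ / f ^ 2 + (1 - θ) ≠ 0 := hθ.ne'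
  set c := θ / f ^ 2 + (1 - θ) with hc_def
  have hsymm : (S⁻¹).IsSymm := by
    simpa [IsHermitian, IsSymm, conjTranspose_eq_transpose_of_trivial] using hS.inv.isHermitian
  have hinv : (f ^ 2 • S)⁻¹ = (f ^ 2)⁻¹ • S⁻¹ := by
    have : Invertible (f ^ 2) := invertibleOfNonzero (by positivity)
    rw [inv_smul S (f ^ 2) hdet.ne'.isUnit, invOf_eq_inv]
  have hdet_smul : (f ^ 2 • S).det = (f ^ 2) ^ m * S.det := by
    rw [det_smul, Fintype.card_fin]
  have hu : (fun _ : Fin m ↦ ν) ⬝ᵥ S⁻¹ *ᵥ (fun _ : Fin m ↦ ν) = ν ^ 2 * s := by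
    have : (fun _ : Fin m ↦ ν) = ν • fun _ ↦ (1 : ℝ) := by ext; simp
    rw [this, mulVec_smul, smul_dotProduct, dotProduct_smul, ← hs, smul_eq_mul, smul_eq_mul]
    ring
  set u : Fin m → ℝ := fun _ ↦ ν
  have hconst (α : ℝ) {d e : ℝ} (hd : 0 < d) :
      ((2 * π) ^ (-(m : ℝ) / 2) * d ^ (-(1 : ℝ) / 2) * Real.exp e) ^ α =
        Real.exp (α * (-(m : ℝ) / 2 * Real.log (2 * π) - Real.log d / 2 + e)) := by
    rw [Real.rpow_def_of_pos (x := 2 * π) (by positivity), Real.rpow_def_of_pos hd,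
      ← Real.exp_add, ← Real.exp_add, ← Real.exp_mul]
    congr 1
    ring
  have hlog : Real.log ((f ^ 2) ^ m * S.det) = 2 * m * Real.log f + Real.log S.det := by
    rw [Real.log_mul (by positivity) hdet.ne', Real.log_pow, Real.log_pow]
    push_cast
    ring
  set K := -(m : ℝ) / 2 * Real.log (2 * π) - θ * m * Real.log f - Real.log S.det / 2 -
    (θ / f ^ 2 - (θ / f ^ 2) ^ 2 / c) * (ν ^ 2 * s) / 2 with hK
  have hintegrand (x : Fin m → ℝ) : q x ^ θ * p x ^ (1 - θ) = Real.exp K *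
      Real.exp (-(c / 2) * ((x - (θ / f ^ 2 / c) • u) ⬝ᵥ S⁻¹ *ᵥ (x - (θ / f ^ 2 / c) • u))) := by
    have hsq := add_dotProduct_mulVec_sub_eq hsymm hc u x
    rw [← hc_def, hu] at hsq
    rw [hp, hq, hdet_smul, hconst θ (by positivity), hconst (1 - θ) hdet, hlog, hinv,
      smul_mulVec, dotProduct_smul, smul_eq_mul, ← Real.exp_add, ← Real.exp_add, hK]
    congr 1
    linear_combination (-1 / 2 : ℝ) * hsq
  simp_rw [hintegrand]
  rw [integral_const_mul,
    integral_sub_right_eq_self fun x : Fin m → ℝ ↦ Real.exp (-(c / 2) * (x ⬝ᵥ S⁻¹ *ᵥ x)),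
    integral_exp_neg_mul_dotProduct_mulVec hS.inv (half_pos hθ), Fintype.card_fin,
    det_nonsing_inv, Ring.inverse_eq_inv',
    show π / (c / 2) = 2 * π / c by field_simp, Real.rpow_def_of_pos (by positivity),
    Real.rpow_def_of_pos (inv_pos.mpr hdet), Real.rpow_def_of_pos hf, Real.rpow_def_of_pos hθ,
    ← Real.exp_add, ← Real.exp_add, ← Real.exp_add, ← Real.exp_add, Real.log_inv,
    Real.log_div (by positivity) hc, hK]
  congr 1
  have hcf : θ * f ^ 2 + (1 - θ) * f ^ 4 = c * f ^ 4 := by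
    rw [hc_def]
    field_simp
  rw [hcf]
  clear_value c
  field_simp
  ring
end
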